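/- Let D be a Γ-invariant linear operator on compactly supported sections of finite propagation speed and (Γ_j) a tower in Γ. Set h_j(t) := tr e^{−tD_{Γ_j}}/[Γ:Γ_j] − tr_Γ e^{−tD} for t > 0. Then there exists Λ > 0 such that for every real λ > Λ and every s ∈ ℂ with Re(s) > −1, the integral ∫₀^∞ t^{s−1} h_j(t) e^{−tλ} dt converges absolutely, and it tends to 0 as j → ∞. -/

import Mathlib

open scoped BigOperators
open Filter

noncomputable section

variable {Y Γ V : Type*}

section Defs

variable [Group Γ] [MulAction Γ Y]
variable [NormedAddCommGroup V] [InnerProductSpace ℂ V]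

/-- The action of `γ ∈ Γ` on compactly (= finitely) supported sections
`φ : Y →₀ V`, given by `(γ · φ)(y) = ρ(γ) φ(γ⁻¹ • y)`. -/
def secAct (ρ : Γ →* (V ≃ₗᵢ[ℂ] V)) (γ : Γ) (φ : Y →₀ V) : Y →₀ V :=
  Finsupp.equivMapDomain (MulAction.toPerm γ) (φ.mapRange (ρ γ) ((ρ γ).map_zero))

/-- A linear operator on compactly supported sections is `Γ`-invariant if it
commutes with the action of `Γ`. -/
def IsEquivariantOp (ρ : Γ →* (V ≃ₗᵢ[ℂ] V)) (D : (Y →₀ V) →ₗ[ℂ] (Y →₀ V)) : Prop :=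
  ∀ (γ : Γ) (φ : Y →₀ V), D (secAct ρ γ φ) = secAct ρ γ (D φ)

/-- The kernel `⟨x|D|y⟩ ∈ End(V)` of an operator `D`, characterized by
`⟨x|D|y⟩ v = (D δ_{y,v})(x)`. -/
def kernelOf (D : (Y →₀ V) →ₗ[ℂ] (Y →₀ V)) (x y : Y) : V →ₗ[ℂ] V :=
  (Finsupp.lapply x) ∘ₗ D ∘ₗ (Finsupp.lsingle y)

/-- `D` has finite propagation speed `≤ R`:
`supp (Dφ) ⊆ U_R(supp φ) = {x | ∃ y ∈ supp φ, d(x,y) ≤ R}`. -/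
def HasPropSpeed [MetricSpace Y] (D : (Y →₀ V) →ₗ[ℂ] (Y →₀ V)) (R : ℝ) : Prop :=
  ∀ (φ : Y →₀ V) (x : Y), D φ x ≠ 0 → ∃ y ∈ φ.support, dist x y ≤ R

/-- A set of representatives of the orbits of a group `G` acting on `Y`:
it contains exactly one point of every orbit. -/
def IsRepSet (G : Type*) [Group G] [MulAction G Y] (S : Set Y) : Prop :=
  ∀ y : Y, ∃! s, s ∈ S ∧ s ∈ MulAction.orbit G y

/-- The space `W_{Γ'}` of `Γ'`-equivariant functions `f : Y → V`,
i.e. `f(γ • y) = ρ(γ) f(y)` for all `γ ∈ Γ'`. -/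
def equivSubmodule (ρ : Γ →* (V ≃ₗᵢ[ℂ] V)) (Γ' : Subgroup Γ) : Submodule ℂ (Y → V) where
  carrier := {f | ∀ (γ : Γ') (y : Y), f ((γ : Γ) • y) = ρ (γ : Γ) (f y)}
  add_mem' := by intro f g hf hg γ y; simp only [Pi.add_apply, hf γ y, hg γ y, map_add]
  zero_mem' := by intro γ y; simp
  smul_mem' := by intro c f hf γ y; simp only [Pi.smul_apply, hf γ y, map_smul]

/-- The summation map `S_{Γ'} φ (y) = Σ_{γ ∈ Γ'} ρ(γ)⁻¹ φ(γ • y)`. -/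
def smap (ρ : Γ →* (V ≃ₗᵢ[ℂ] V)) (Γ' : Subgroup Γ) (φ : Y →₀ V) : Y → V :=
  fun y => ∑ᶠ γ : Γ', ρ ((γ : Γ)⁻¹) (φ ((γ : Γ) • y))

/-- `DG` is the pushdown of `D` to `W_{Γ'}`, i.e. `DG ∘ S_{Γ'} = S_{Γ'} ∘ D`. -/
def IsPushdown (ρ : Γ →* (V ≃ₗᵢ[ℂ] V)) (Γ' : Subgroup Γ)
    (D : (Y →₀ V) →ₗ[ℂ] (Y →₀ V))
    (DG : equivSubmodule (Y := Y) ρ Γ' →ₗ[ℂ] equivSubmodule (Y := Y) ρ Γ') : Prop :=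
  ∀ (w : equivSubmodule (Y := Y) ρ Γ') (φ : Y →₀ V),
    (w : Y → V) = smap ρ Γ' φ → ((DG w : Y → V) = smap ρ Γ' (D φ))

/-- The kernel `⟨x|D|y⟩`, as a continuous linear map on `V`. -/
def kernelOfL [FiniteDimensional ℂ V] (D : (Y →₀ V) →ₗ[ℂ] (Y →₀ V)) (x y : Y) : V →L[ℂ] V :=
  LinearMap.toContinuousLinearMap (kernelOf D x y)

/-- The heat kernel `⟨x|e^{zD}|y⟩ = Σ_{n ≥ 0} (zⁿ/n!) ⟨x|Dⁿ|y⟩`. -/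
def heatKer [FiniteDimensional ℂ V] (D : (Y →₀ V) →ₗ[ℂ] (Y →₀ V)) (z : ℂ) (x y : Y) :
    V →L[ℂ] V :=
  ∑' n : ℕ, (z ^ n / (n.factorial : ℂ)) • kernelOfL (D ^ n) x y

/-- The `Γ`-trace `tr_Γ e^{zD} = Σ_{s ∈ S} tr ⟨s|e^{zD}|s⟩`,
for a set `S` of representatives of the `Γ`-orbits. -/
def trGammaHeat [FiniteDimensional ℂ V] (D : (Y →₀ V) →ₗ[ℂ] (Y →₀ V)) (z : ℂ)
    (S : Set Y) : ℂ :=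
  ∑ᶠ s ∈ S, LinearMap.trace ℂ V ((heatKer D z s s : V →L[ℂ] V) : V →ₗ[ℂ] V)

/-- `tr e^{zT}` for an endomorphism `T` of a finite dimensional space,
via the exponential series `Σ_{n ≥ 0} (zⁿ/n!) tr(Tⁿ)`. -/
def trExp {W : Type*} [AddCommGroup W] [Module ℂ W] (T : W →ₗ[ℂ] W) (z : ℂ) : ℂ :=
  ∑' n : ℕ, z ^ n / (n.factorial : ℂ) * LinearMap.trace ℂ W (T ^ n)

end Defs

theorem norm_exp_term_smul_le {E : Type*} [SeminormedAddCommGroup E] [NormedSpace ℂ E]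
    {v : ℕ → E} {C M : ℝ} (hv : ∀ n, ‖v n‖ ≤ C * M ^ n) (z : ℂ) (n : ℕ) :
    ‖(z ^ n / (n.factorial : ℂ)) • v n‖ ≤ C * ((‖z‖ * M) ^ n / (n.factorial : ℝ)) := by
  rw [norm_smul, norm_div, norm_pow, Complex.norm_natCast, mul_pow]
  calc ‖z‖ ^ n / (n.factorial : ℝ) * ‖v n‖ ≤ ‖z‖ ^ n / (n.factorial : ℝ) * (C * M ^ n) := by
        gcongr; exact hv n
    _ = _ := by ring

theorem summable_exp_term_smul {E : Type*} [NormedAddCommGroup E] [NormedSpace ℂ E]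
    [CompleteSpace E] {v : ℕ → E} {C M : ℝ} (hv : ∀ n, ‖v n‖ ≤ C * M ^ n) (z : ℂ) :
    Summable fun n : ℕ => (z ^ n / (n.factorial : ℂ)) • v n :=
  ((Real.summable_pow_div_factorial (‖z‖ * M)).mul_left C).of_norm_bounded
    (norm_exp_term_smul_le hv z)

open MeasureTheory in
theorem mellin_tendsto_zero_of_series {a : ℕ → ℕ → ℂ} {C M : ℝ}
    (hbound : ∀ j n, ‖a j n‖ ≤ C * M ^ n) (hzero : ∀ j, a j 0 = 0)
    (hev : ∀ n, ∀ᶠ j in atTop, a j n = 0) {h : ℕ → ℝ → ℂ}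
    (hh : ∀ j t, h j t = ∑' n : ℕ, (-(t : ℂ)) ^ n / (n.factorial : ℂ) * a j n)
    {lam : ℝ} (hlam : M < lam) {s : ℂ} (hs : -1 < s.re) :
    (∀ j : ℕ, IntegrableOn
        (fun t : ℝ => (t : ℂ) ^ (s - 1) * h j t * Complex.exp (-(↑(t * lam) : ℂ)))
        (Set.Ioi 0)) ∧
      Tendsto
        (fun j : ℕ => ∫ t in Set.Ioi (0 : ℝ),
          (t : ℂ) ^ (s - 1) * h j t * Complex.exp (-(↑(t * lam) : ℂ)))
        atTop (nhds 0) := by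
  have hC : 0 ≤ C := by simpa using (norm_nonneg _).trans (hbound 0 0)
  have hexp (x : ℝ) : Summable fun n : ℕ => C * (x ^ n / (n.factorial : ℝ)) :=
    (Real.summable_pow_div_factorial x).mul_left C
  have hterm (j n : ℕ) (t : ℝ) : ‖(-(t : ℂ)) ^ n / (n.factorial : ℂ) * a j n‖
      ≤ C * ((|t| * M) ^ n / (n.factorial : ℝ)) := by
    simpa using norm_exp_term_smul_le (hbound j) (-(t : ℂ)) n
  have hsum (j : ℕ) (t : ℝ) :
      Summable fun n : ℕ => (-(t : ℂ)) ^ n / (n.factorial : ℂ) * a j n :=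
    (hexp (|t| * M)).of_norm_bounded (hterm j · t)
  have hmeas (j : ℕ) : Measurable (h j) := by
    have hlim : Tendsto
        (fun (N : ℕ) (t : ℝ) => ∑ n ∈ Finset.range N, (-(t : ℂ)) ^ n / (n.factorial : ℂ) * a j n)
        atTop (nhds (h j)) := by
      rw [tendsto_pi_nhds]
      intro t
      rw [hh]
      exact (hsum j t).hasSum.tendsto_sum_nat
    exact measurable_of_tendsto_metrizable (fun N => by fun_prop) hlim
  have hnorm (j : ℕ) (t : ℝ) (ht : 0 < t) : ‖h j t‖ ≤ C * M * t * Real.exp (t * M) := by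
    have h1 : HasSum (fun n : ℕ => C * ((t * M) ^ (n + 1) / ((n + 1).factorial : ℝ)))
        (C * (Real.exp (t * M) - 1)) := by
      have := NormedSpace.expSeries_div_hasSum_exp (t * M)
      rw [← Real.exp_eq_exp_ℝ, ← hasSum_nat_add_iff' 1] at this
      simpa using this.mul_left C
    have h2 : h j t = ∑' n : ℕ, (-(t : ℂ)) ^ (n + 1) / ((n + 1).factorial : ℂ) * a j (n + 1) := by
      rw [hh, (hsum j t).tsum_eq_zero_add]
      simp [hzero]
    have h3 : ‖h j t‖ ≤ C * (Real.exp (t * M) - 1) := by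
      rw [h2]
      refine tsum_of_norm_bounded h1 fun n => ?_
      simpa [abs_of_pos ht] using hterm j (n + 1) t
    have h4 : Real.exp (t * M) - 1 ≤ t * M * Real.exp (t * M) := by
      have h5 := Real.add_one_le_exp (-(t * M))
      have h6 : Real.exp (-(t * M)) * Real.exp (t * M) = 1 := by
        rw [← Real.exp_add]; simp
      nlinarith [Real.exp_pos (t * M)]
    calc ‖h j t‖ ≤ C * (t * M * Real.exp (t * M)) := h3.trans (by gcongr)
      _ = _ := by ring
  have hpt (t : ℝ) : Tendsto (fun j => h j t) atTop (nhds 0) := by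
    simp_rw [hh]
    have := tendsto_tsum_of_dominated_convergence (𝓕 := atTop)
      (f := fun j n => (-(t : ℂ)) ^ n / (n.factorial : ℂ) * a j n) (g := fun _ => 0)
      (hexp (|t| * M)) (fun n => tendsto_const_nhds.congr' ?_)
      (Eventually.of_forall fun j n => hterm j n t)
    · simpa using this
    · filter_upwards [hev n] with j hj
      simp [hj]
  have hdom : IntegrableOn
      (fun t : ℝ => C * M * (t ^ s.re * Real.exp (-(lam - M) * t ^ (1 : ℝ)))) (Set.Ioi 0) :=
    (integrableOn_rpow_mul_exp_neg_mul_rpow hs zero_lt_one (sub_pos.2 hlam)).const_mul _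
  have haesm (j : ℕ) : AEStronglyMeasurable
      (fun t : ℝ => (t : ℂ) ^ (s - 1) * h j t * Complex.exp (-(↑(t * lam) : ℂ)))
      (volume.restrict (Set.Ioi 0)) := by
    have := hmeas j
    exact Measurable.aestronglyMeasurable (by fun_prop)
  have hle (j : ℕ) : ∀ᵐ t : ℝ ∂(volume.restrict (Set.Ioi (0 : ℝ))),
      ‖(t : ℂ) ^ (s - 1) * h j t * Complex.exp (-(↑(t * lam) : ℂ))‖
        ≤ C * M * (t ^ s.re * Real.exp (-(lam - M) * t ^ (1 : ℝ))) := by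
    refine ae_restrict_of_forall_mem measurableSet_Ioi fun t (ht : 0 < t) => ?_
    rw [norm_mul, norm_mul, Complex.norm_cpow_eq_rpow_re_of_pos ht, Complex.norm_exp,
      Complex.neg_re, Complex.ofReal_re, Complex.sub_re, Complex.one_re, Real.rpow_one]
    calc t ^ (s.re - 1) * ‖h j t‖ * Real.exp (-(t * lam))
        ≤ t ^ (s.re - 1) * (C * M * t * Real.exp (t * M)) * Real.exp (-(t * lam)) := by
          gcongr; exact hnorm j t ht
      _ = C * M * (t ^ (s.re - 1) * t * (Real.exp (t * M) * Real.exp (-(t * lam)))) := by ring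
      _ = _ := by
          rw [← Real.exp_add, ← Real.rpow_add_one ht.ne', sub_add_cancel]
          ring_nf
  refine ⟨fun j => hdom.mono' (haesm j) (hle j), ?_⟩
  have := tendsto_integral_of_dominated_convergence
    (f := fun _ => (0 : ℂ)) _ haesm hdom hle (Eventually.of_forall fun t => ?_)
  · simpa using this
  · simpa using ((hpt t).const_mul ((t : ℂ) ^ (s - 1))).mul_const
      (Complex.exp (-(↑(t * lam) : ℂ)))

theorem map_mul_apply_isometryEquiv [Group Γ] [NormedAddCommGroup V] [InnerProductSpace ℂ V]
    (ρ : Γ →* (V ≃ₗᵢ[ℂ] V)) (a b : Γ) (v : V) : ρ (a * b) v = ρ a (ρ b v) := by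
  rw [map_mul]
  rfl

section Norm

variable [NormedAddCommGroup V]

/-- The `ℓ¹`-norm of a finitely supported section. -/
def l1Norm (φ : Y →₀ V) : ℝ := φ.sum fun _ v => ‖v‖

theorem l1Norm_eq_sum {φ : Y →₀ V} {T : Finset Y} (hT : φ.support ⊆ T) :
    l1Norm φ = ∑ x ∈ T, ‖φ x‖ :=
  Finsupp.sum_of_support_subset _ hT _ (by simp)

theorem l1Norm_single (y : Y) (v : V) : l1Norm (Finsupp.single y v) = ‖v‖ := by
  simp [l1Norm]

theorem l1Norm_nonneg (φ : Y →₀ V) : 0 ≤ l1Norm φ :=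
  Finset.sum_nonneg fun _ _ => norm_nonneg _

theorem sum_norm_le_l1Norm (φ : Y →₀ V) (T : Finset Y) : ∑ x ∈ T, ‖φ x‖ ≤ l1Norm φ := by
  classical
  rw [l1Norm_eq_sum (T := φ.support ∪ T) Finset.subset_union_left]
  exact Finset.sum_le_sum_of_subset_of_nonneg Finset.subset_union_right
    fun _ _ _ => norm_nonneg _

theorem norm_apply_le_l1Norm (φ : Y →₀ V) (y : Y) : ‖φ y‖ ≤ l1Norm φ := by
  simpa using sum_norm_le_l1Norm φ {y}

theorem l1Norm_add_le (φ ψ : Y →₀ V) : l1Norm (φ + ψ) ≤ l1Norm φ + l1Norm ψ := by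
  classical
  rw [l1Norm_eq_sum (T := φ.support ∪ ψ.support) Finsupp.support_add,
    l1Norm_eq_sum (T := φ.support ∪ ψ.support) Finset.subset_union_left,
    l1Norm_eq_sum (T := φ.support ∪ ψ.support) Finset.subset_union_right,
    ← Finset.sum_add_distrib]
  exact Finset.sum_le_sum fun _ _ => norm_add_le _ _

theorem l1Norm_sum_le {ι : Type*} (T : Finset ι) (f : ι → Y →₀ V) :
    l1Norm (∑ i ∈ T, f i) ≤ ∑ i ∈ T, l1Norm (f i) :=
  Finset.le_sum_of_subadditive _ (by simp [l1Norm]) l1Norm_add_le _ _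

theorem l1Norm_smul [NormedSpace ℂ V] (c : ℂ) (φ : Y →₀ V) :
    l1Norm (c • φ) = ‖c‖ * l1Norm φ := by
  rw [l1Norm_eq_sum (T := φ.support) Finsupp.support_smul, l1Norm_eq_sum subset_rfl,
    Finset.mul_sum]
  simp [norm_smul]

theorem exists_l1Norm_linearMap_le [InnerProductSpace ℂ V] [FiniteDimensional ℂ V]
    (L : V →ₗ[ℂ] (Y →₀ V)) : ∃ C : ℝ, 0 ≤ C ∧ ∀ v, l1Norm (L v) ≤ C * ‖v‖ := by
  let b := stdOrthonormalBasis ℂ V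
  refine ⟨∑ i, l1Norm (L (b i)), Finset.sum_nonneg fun _ _ => l1Norm_nonneg _, fun v => ?_⟩
  calc l1Norm (L v) = l1Norm (∑ i, inner ℂ (b i) v • L (b i)) := by
        conv_lhs => rw [← b.sum_repr' v]
        simp only [map_sum, map_smul]
    _ ≤ ∑ i, l1Norm (inner ℂ (b i) v • L (b i)) := l1Norm_sum_le _ _
    _ ≤ ∑ i, l1Norm (L (b i)) * ‖v‖ := by
        refine Finset.sum_le_sum fun i _ => ?_
        rw [l1Norm_smul, mul_comm]
        gcongr
        · exact l1Norm_nonneg _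
        · simpa using norm_inner_le_norm (𝕜 := ℂ) (b i) v
    _ = _ := by rw [Finset.sum_mul]

end Norm

section Action

variable [Group Γ] [MulAction Γ Y]

theorem IsRepSet.finite [Finite (MulAction.orbitRel.Quotient Γ Y)] {S : Set Y}
    (hS : IsRepSet Γ S) : S.Finite := by
  refine Set.Finite.of_injOn (t := Set.univ)
    (f := fun y => (Quotient.mk _ y : MulAction.orbitRel.Quotient Γ Y))
    (fun _ _ => Set.mem_univ _) (fun s hs t ht hst => ?_) Set.finite_univ
  have hmem : s ∈ MulAction.orbit Γ t := MulAction.orbitRel_apply.1 (Quotient.exact hst)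
  exact (hS t).unique ⟨hs, hmem⟩ ⟨ht, MulAction.mem_orbit_self t⟩

theorem IsRepSet.exists_smul_eq {S : Set Y} (hS : IsRepSet Γ S) (y : Y) :
    ∃ s ∈ S, ∃ g : Γ, g • s = y := by
  obtain ⟨s, ⟨hs, hsy⟩, -⟩ := hS y
  obtain ⟨g, hg⟩ := MulAction.orbit_eq_iff.2 hsy ▸ MulAction.mem_orbit_self y
  exact ⟨s, hs, g, hg⟩

theorem IsRepSet.eq_of_smul_eq {S : Set Y} (hS : IsRepSet Γ S) {s t : Y} (hs : s ∈ S)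
    (ht : t ∈ S) {g : Γ} (h : g • s = t) : s = t :=
  (hS s).unique ⟨hs, MulAction.mem_orbit_self s⟩ ⟨ht, g, h⟩

theorem smul_left_injective_of_free (hfree : ∀ (γ : Γ) (y : Y), γ • y = y → γ = 1) (y : Y) :
    Function.Injective fun γ : Γ => γ • y := by
  intro a b hab
  have : (b⁻¹ * a) • y = y := by
    rw [mul_smul, inv_smul_eq_iff]
    exact hab
  exact (inv_mul_eq_one.1 (hfree _ _ this)).symm

theorem exists_finset_smul_mem_support {M : Type*} [Zero M]
    (hfree : ∀ (γ : Γ) (y : Y), γ • y = y → γ = 1) (Γ' : Subgroup Γ) (φ : Y →₀ M)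
    (y : Y) : ∃ T : Finset Γ', ∀ γ : Γ', φ ((γ : Γ) • y) ≠ 0 → γ ∈ T := by
  have hinj : Function.Injective fun γ : Γ' => (γ : Γ) • y :=
    (smul_left_injective_of_free hfree y).comp Subtype.val_injective
  exact ⟨φ.support.preimage _ hinj.injOn, fun γ h => by simpa using h⟩

variable [NormedAddCommGroup V] [InnerProductSpace ℂ V] {ρ : Γ →* (V ≃ₗᵢ[ℂ] V)}

theorem secAct_apply (γ : Γ) (φ : Y →₀ V) (y : Y) :
    secAct ρ γ φ y = ρ γ (φ (γ⁻¹ • y)) := rfl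

theorem secAct_single (γ : Γ) (y : Y) (v : V) :
    secAct ρ γ (Finsupp.single y v) = Finsupp.single (γ • y) (ρ γ v) := by
  simp [secAct]

theorem l1Norm_secAct (γ : Γ) (φ : Y →₀ V) : l1Norm (secAct ρ γ φ) = l1Norm φ := by
  unfold l1Norm secAct
  rw [Finsupp.equivMapDomain_eq_mapDomain,
    Finsupp.sum_mapDomain_index_inj (MulAction.toPerm γ).injective,
    Finsupp.sum_mapRange_index (by simp)]
  simp

theorem IsEquivariantOp.pow {D : (Y →₀ V) →ₗ[ℂ] (Y →₀ V)} (hD : IsEquivariantOp ρ D) (n : ℕ) :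
    IsEquivariantOp ρ (D ^ n) := by
  induction n with
  | zero => intro γ φ; simp
  | succ n ih => intro γ φ; simp only [pow_succ', Module.End.mul_apply, ih γ φ, hD γ]

theorem IsPushdown.pow {Γ' : Subgroup Γ} {D : (Y →₀ V) →ₗ[ℂ] (Y →₀ V)}
    {DG : equivSubmodule (Y := Y) ρ Γ' →ₗ[ℂ] equivSubmodule (Y := Y) ρ Γ'}
    (hDG : IsPushdown ρ Γ' D DG) (n : ℕ) : IsPushdown ρ Γ' (D ^ n) (DG ^ n) := by
  induction n with
  | zero => intro w φ h; simpa using h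
  | succ n ih =>
    intro w φ h
    simp only [pow_succ', Module.End.mul_apply]
    exact hDG _ _ (ih w φ h)

theorem IsEquivariantOp.exists_l1Norm_le [FiniteDimensional ℂ V]
    {D : (Y →₀ V) →ₗ[ℂ] (Y →₀ V)} (hD : IsEquivariantOp ρ D) {S : Set Y} (hS : IsRepSet Γ S)
    (hfin : S.Finite) : ∃ M : ℝ, 0 ≤ M ∧ ∀ φ, l1Norm (D φ) ≤ M * l1Norm φ := by
  choose C hC0 hC using fun y : Y => exists_l1Norm_linearMap_le (D ∘ₗ Finsupp.lsingle y)
  have hsum : ∀ y ∈ S, C y ≤ ∑ s ∈ hfin.toFinset, C s := fun y hy =>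
    Finset.single_le_sum (fun s _ => hC0 s) (hfin.mem_toFinset.2 hy)
  refine ⟨∑ s ∈ hfin.toFinset, C s, Finset.sum_nonneg fun s _ => hC0 s, fun φ => ?_⟩
  have hsingle (y : Y) (v : V) :
      l1Norm (D (Finsupp.single y v)) ≤ (∑ s ∈ hfin.toFinset, C s) * ‖v‖ := by
    obtain ⟨s, hs, g, rfl⟩ := hS.exists_smul_eq y
    have h1 : Finsupp.single (g • s) v = secAct ρ g (Finsupp.single s ((ρ g).symm v)) := by
      simp [secAct_single]
    rw [h1, hD, l1Norm_secAct]
    refine (hC s _).trans ?_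
    rw [LinearIsometryEquiv.norm_map]
    gcongr
    exact hsum s hs
  calc l1Norm (D φ) = l1Norm (∑ y ∈ φ.support, D (Finsupp.single y (φ y))) := by
        conv_lhs => rw [← φ.sum_single, Finsupp.sum, map_sum]
    _ ≤ ∑ y ∈ φ.support, l1Norm (D (Finsupp.single y (φ y))) := l1Norm_sum_le _ _
    _ ≤ ∑ y ∈ φ.support, (∑ s ∈ hfin.toFinset, C s) * ‖φ y‖ :=
        Finset.sum_le_sum fun y _ => hsingle y _
    _ = _ := by rw [← Finset.mul_sum]; rfl

theorem l1Norm_pow_le {D : (Y →₀ V) →ₗ[ℂ] (Y →₀ V)} {M : ℝ} (hM : 0 ≤ M)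
    (hD : ∀ φ, l1Norm (D φ) ≤ M * l1Norm φ) (n : ℕ) (φ : Y →₀ V) :
    l1Norm ((D ^ n) φ) ≤ M ^ n * l1Norm φ := by
  induction n with
  | zero => simp
  | succ n ih =>
    rw [pow_succ', Module.End.mul_apply, pow_succ', mul_assoc]
    exact (hD _).trans (by gcongr)

end Action

section Periodization

variable [Group Γ] [MulAction Γ Y] [NormedAddCommGroup V] [InnerProductSpace ℂ V]
  {ρ : Γ →* (V ≃ₗᵢ[ℂ] V)}

theorem smap_eq_sum (Γ' : Subgroup Γ)
    (φ : Y →₀ V) (y : Y) {T : Finset Γ'} (hT : ∀ γ : Γ', φ ((γ : Γ) • y) ≠ 0 → γ ∈ T) :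
    smap ρ Γ' φ y = ∑ γ ∈ T, ρ ((γ : Γ)⁻¹) (φ ((γ : Γ) • y)) := by
  refine finsum_eq_sum_of_support_subset _ fun γ hγ => hT γ fun h0 => hγ ?_
  simp [h0]

theorem norm_smap_le (hfree : ∀ (γ : Γ) (y : Y), γ • y = y → γ = 1) (Γ' : Subgroup Γ)
    (φ : Y →₀ V) (y : Y) : ‖smap ρ Γ' φ y‖ ≤ l1Norm φ := by
  classical
  have hinj : Function.Injective fun γ : Γ' => (γ : Γ) • y :=
    (smul_left_injective_of_free hfree y).comp Subtype.val_injective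
  obtain ⟨T, hT⟩ := exists_finset_smul_mem_support hfree Γ' φ y
  rw [smap_eq_sum Γ' φ y hT]
  calc _ ≤ ∑ γ ∈ T, ‖ρ ((γ : Γ)⁻¹) (φ ((γ : Γ) • y))‖ := norm_sum_le _ _
    _ = ∑ x ∈ T.image fun γ : Γ' => (γ : Γ) • y, ‖φ x‖ := by
        rw [Finset.sum_image hinj.injOn]
        simp
    _ ≤ _ := sum_norm_le_l1Norm _ _

theorem smap_smul (Γ' : Subgroup Γ) (φ : Y →₀ V) (γ : Γ') (y : Y) :
    smap ρ Γ' φ ((γ : Γ) • y) = ρ (γ : Γ) (smap ρ Γ' φ y) := by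
  unfold smap
  rw [AddEquivClass.map_finsum (ρ (γ : Γ)), eq_comm, ← finsum_comp_equiv (Equiv.mulRight γ)]
  refine finsum_congr fun γ' => ?_
  simp [-map_inv, -map_mul, mul_smul, ← map_mul_apply_isometryEquiv]

theorem smap_secAct (Γ' : Subgroup Γ) [hn : Γ'.Normal] (g : Γ) (φ : Y →₀ V) (y : Y) :
    smap ρ Γ' (secAct ρ g φ) (g • y) = ρ g (smap ρ Γ' φ y) := by
  unfold smap
  rw [AddEquivClass.map_finsum (ρ g), eq_comm,
    ← finsum_comp_equiv (MulAut.conjNormal g⁻¹ : Γ' ≃* Γ').toEquiv]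
  refine finsum_congr fun γ' => ?_
  simp [-map_inv, -map_mul, secAct_apply, mul_smul, ← map_mul_apply_isometryEquiv]

/-- The summation map `S_{Γ'}` as a linear map into the space of `Γ'`-equivariant functions. -/
def smapLinear (ρ : Γ →* (V ≃ₗᵢ[ℂ] V)) (hfree : ∀ (γ : Γ) (y : Y), γ • y = y → γ = 1)
    (Γ' : Subgroup Γ) : (Y →₀ V) →ₗ[ℂ] equivSubmodule (Y := Y) ρ Γ' where
  toFun φ := ⟨smap ρ Γ' φ, smap_smul Γ' φ⟩
  map_add' φ ψ := by
    classical
    ext y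
    obtain ⟨T, hT⟩ := exists_finset_smul_mem_support hfree Γ' φ y
    obtain ⟨T', hT'⟩ := exists_finset_smul_mem_support hfree Γ' ψ y
    change smap ρ Γ' (φ + ψ) y = smap ρ Γ' φ y + smap ρ Γ' ψ y
    rw [smap_eq_sum Γ' φ y (T := T ∪ T') (by grind),
      smap_eq_sum Γ' ψ y (T := T ∪ T') (by grind),
      smap_eq_sum Γ' (φ + ψ) y (T := T ∪ T') ?_, ← Finset.sum_add_distrib]
    · simp
    · intro γ h
      by_contra hγ
      have h1 : φ ((γ : Γ) • y) = 0 := by grind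
      have h2 : ψ ((γ : Γ) • y) = 0 := by grind
      simp [h1, h2] at h
  map_smul' c φ := by
    ext y
    obtain ⟨T, hT⟩ := exists_finset_smul_mem_support hfree Γ' φ y
    change smap ρ Γ' (c • φ) y = c • smap ρ Γ' φ y
    rw [smap_eq_sum Γ' φ y hT, smap_eq_sum Γ' (c • φ) y (T := T) ?_,
      Finset.smul_sum]
    · simp
    · intro γ h
      exact hT γ fun h0 => h (by simp [h0])

theorem eventually_smap_eq (hfree : ∀ (γ : Γ) (y : Y), γ • y = y → γ = 1)
    {Γs : ℕ → Subgroup Γ} (hdec : ∀ j, Γs (j + 1) ≤ Γs j) (hinter : (⨅ j, Γs j) = ⊥)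
    (φ : Y →₀ V) (y : Y) : ∀ᶠ j in atTop, smap ρ (Γs j) φ y = φ y := by
  have hanti : Antitone Γs := antitone_nat_of_succ_le hdec
  have hfin : {γ : Γ | φ (γ • y) ≠ 0}.Finite :=
    (φ.support.preimage _ (smul_left_injective_of_free hfree y).injOn).finite_toSet.subset
      fun γ h => by simpa using h
  have hev : ∀ᶠ j in atTop, ∀ γ ∈ {γ : Γ | φ (γ • y) ≠ 0}, γ ≠ 1 → γ ∉ Γs j := by
    rw [hfin.eventually_all]
    intro γ _
    by_cases h1 : γ = 1
    · simp [h1]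
    · have : γ ∉ ⨅ j, Γs j := by simpa [hinter] using h1
      obtain ⟨j, hj⟩ := by simpa [Subgroup.mem_iInf] using this
      filter_upwards [eventually_ge_atTop j] with k hk _ hmem
      exact hj (hanti hk hmem)
  filter_upwards [hev] with j hj
  rw [smap_eq_sum (Γs j) φ y (T := {1})]
  · simp [-map_inv]
  · intro γ h
    by_contra hne
    exact hj γ h (by simpa using hne) γ.2

end Periodization

section Trace

variable [Group Γ] [MulAction Γ Y] [NormedAddCommGroup V] [InnerProductSpace ℂ V]
  {ρ : Γ →* (V ≃ₗᵢ[ℂ] V)}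

theorem smap_single_of_smul_eq (hfree : ∀ (γ : Γ) (y : Y), γ • y = y → γ = 1)
    (Γ' : Subgroup Γ) {γ : Γ'} {x y : Y} (h : (γ : Γ) • y = x) (v : V) :
    smap ρ Γ' (Finsupp.single x v) y = ρ ((γ : Γ)⁻¹) v := by
  classical
  rw [smap_eq_sum Γ' _ y (T := {γ})]
  · simp [h]
  · intro γ' hγ'
    have h1 : x = (γ' : Γ) • y := by
      by_contra hne
      exact hγ' (Finsupp.single_eq_of_ne' hne)
    have h2 : (γ' : Γ) = γ := smul_left_injective_of_free hfree y (by simp [h, ← h1])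
    simpa using Subtype.ext h2

theorem smap_single_of_forall_smul_ne (Γ' : Subgroup Γ) {x y : Y}
    (h : ∀ γ : Γ', (γ : Γ) • y ≠ x) (v : V) :
    smap ρ Γ' (Finsupp.single x v) y = 0 := by
  rw [smap_eq_sum Γ' _ y (T := ∅)]
  · simp
  · intro γ hγ
    exact absurd (Finsupp.single_eq_of_ne (h γ)) hγ

/-- The diagonal value at `y` of the kernel of the operator induced by `E` on
`Γ'`-equivariant functions. -/
def periodizedKernel (ρ : Γ →* (V ≃ₗᵢ[ℂ] V)) (hfree : ∀ (γ : Γ) (y : Y), γ • y = y → γ = 1)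
    (Γ' : Subgroup Γ) (E : (Y →₀ V) →ₗ[ℂ] (Y →₀ V)) (y : Y) : V →ₗ[ℂ] V :=
  LinearMap.proj y ∘ₗ (equivSubmodule (Y := Y) ρ Γ').subtype ∘ₗ smapLinear ρ hfree Γ' ∘ₗ E ∘ₗ
    Finsupp.lsingle y

theorem periodizedKernel_apply (hfree : ∀ (γ : Γ) (y : Y), γ • y = y → γ = 1)
    (Γ' : Subgroup Γ) (E : (Y →₀ V) →ₗ[ℂ] (Y →₀ V)) (y : Y) (v : V) :
    periodizedKernel ρ hfree Γ' E y v = smap ρ Γ' (E (Finsupp.single y v)) y := rfl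

theorem trace_periodizedKernel_smul (hfree : ∀ (γ : Γ) (y : Y), γ • y = y → γ = 1)
    (Γ' : Subgroup Γ) [Γ'.Normal] {E : (Y →₀ V) →ₗ[ℂ] (Y →₀ V)} (hE : IsEquivariantOp ρ E)
    (g : Γ) (y : Y) :
    LinearMap.trace ℂ V (periodizedKernel ρ hfree Γ' E (g • y)) =
      LinearMap.trace ℂ V (periodizedKernel ρ hfree Γ' E y) := by
  rw [← LinearMap.trace_conj' (periodizedKernel ρ hfree Γ' E y) (ρ g).toLinearEquiv]
  congr 1
  ext v
  have h1 : Finsupp.single (g • y) v = secAct ρ g (Finsupp.single y ((ρ g).symm v)) := by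
    simp [secAct_single]
  rw [periodizedKernel_apply, h1, hE, smap_secAct]
  rfl

theorem sum_smap_single_eq (hfree : ∀ (γ : Γ) (y : Y), γ • y = y → γ = 1)
    {S : Set Y} (hS : IsRepSet Γ S) (hfin : S.Finite) (Γ' : Subgroup Γ) [Γ'.Normal]
    [Fintype (Γ ⧸ Γ')] (w : equivSubmodule (Y := Y) ρ Γ') (y : Y) :
    ∑ q : Γ ⧸ Γ', ∑ s ∈ hfin.toFinset,
      smap ρ Γ' (Finsupp.single (q.out • s) ((w : Y → V) (q.out • s))) y = (w : Y → V) y := by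
  classical
  obtain ⟨s₀, hs₀, g, rfl⟩ := hS.exists_smul_eq y
  obtain ⟨γ, hγ⟩ := QuotientGroup.mk_out_eq_mul Γ' g
  have hne (q : Γ ⧸ Γ') (s : Y) (hs : s ∈ S) (v : V) (h : q ≠ (g : Γ ⧸ Γ') ∨ s ≠ s₀) :
      smap ρ Γ' (Finsupp.single (q.out • s) v) (g • s₀) = 0 := by
    refine smap_single_of_forall_smul_ne Γ' (fun γ' h' => ?_) v
    have h1 : (q.out⁻¹ * (γ' * g)) • s₀ = s := by rw [mul_smul, mul_smul, h', inv_smul_smul]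
    have h2 : s₀ = s := hS.eq_of_smul_eq hs₀ hs h1
    subst h2
    have h3 : q.out = γ' * g := inv_mul_eq_one.1 (hfree _ _ h1)
    refine h.elim (fun hq => hq ?_) (fun hs => hs rfl)
    rw [← q.out_eq', h3, QuotientGroup.eq]
    simpa using ‹Γ'.Normal›.conj_mem _ (inv_mem γ'.2) g⁻¹
  rw [Finset.sum_eq_single (g : Γ ⧸ Γ')
      (fun q _ hq => Finset.sum_eq_zero fun s hs =>
        hne q s (hfin.mem_toFinset.1 hs) _ (Or.inl hq)) (by simp),
    Finset.sum_eq_single s₀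
      (fun s hs hss => hne _ s (hfin.mem_toFinset.1 hs) _ (Or.inr hss))
      (fun h => absurd (hfin.mem_toFinset.2 hs₀) h)]
  let γ' : Γ' := ⟨g * γ * g⁻¹, ‹Γ'.Normal›.conj_mem _ γ.2 g⟩
  have h' : (γ' : Γ) • g • s₀ = (g : Γ ⧸ Γ').out • s₀ := by
    rw [hγ, ← mul_smul]
    simp [γ']
  rw [smap_single_of_smul_eq hfree Γ' h', ← h', w.2 γ' (g • s₀),
    ← map_mul_apply_isometryEquiv]
  simp [-map_inv]

theorem trace_pushdown [FiniteDimensional ℂ V]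
    (hfree : ∀ (γ : Γ) (y : Y), γ • y = y → γ = 1)
    {S : Set Y} (hS : IsRepSet Γ S) (hfin : S.Finite) (Γ' : Subgroup Γ) [Γ'.Normal]
    [Γ'.FiniteIndex] {E : (Y →₀ V) →ₗ[ℂ] (Y →₀ V)} (hE : IsEquivariantOp ρ E)
    {EG : equivSubmodule (Y := Y) ρ Γ' →ₗ[ℂ] equivSubmodule (Y := Y) ρ Γ'}
    (hEG : IsPushdown ρ Γ' E EG) :
    LinearMap.trace ℂ _ EG = Γ'.index *
      ∑ s ∈ hfin.toFinset, LinearMap.trace ℂ V (periodizedKernel ρ hfree Γ' E s) := by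
  classical
  have := Γ'.fintypeQuotientOfFiniteIndex
  let π (y : Y) : equivSubmodule (Y := Y) ρ Γ' →ₗ[ℂ] V :=
    LinearMap.proj y ∘ₗ (equivSubmodule (Y := Y) ρ Γ').subtype
  let ι (y : Y) : V →ₗ[ℂ] equivSubmodule (Y := Y) ρ Γ' :=
    smapLinear ρ hfree Γ' ∘ₗ Finsupp.lsingle y
  have hid : ∑ q : Γ ⧸ Γ', ∑ s ∈ hfin.toFinset, ι (q.out • s) ∘ₗ π (q.out • s) =
      LinearMap.id := by
    ext w y
    rw [LinearMap.id_apply, ← sum_smap_single_eq hfree hS hfin Γ' w y]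
    simp only [LinearMap.sum_apply, Submodule.coe_sum, Finset.sum_apply]
    rfl
  have hfd : FiniteDimensional ℂ (equivSubmodule (Y := Y) ρ Γ') := by
    refine Module.Finite.of_injective
      (LinearMap.pi fun p : (Γ ⧸ Γ') × hfin.toFinset => π (p.1.out • (p.2 : Y))) ?_
    rw [← LinearMap.ker_eq_bot, LinearMap.ker_eq_bot']
    intro w hw
    rw [← LinearMap.id_apply (R := ℂ) w, ← hid]
    simp only [LinearMap.sum_apply]
    refine Finset.sum_eq_zero fun q _ => Finset.sum_eq_zero fun s hs => ?_
    have : π (q.out • s) w = 0 := congrFun hw (q, ⟨s, hs⟩)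
    simp [this]
  have hcomp (y : Y) : π y ∘ₗ EG ∘ₗ ι y = periodizedKernel ρ hfree Γ' E y := by
    ext v
    exact congrFun (hEG _ (Finsupp.single y v) rfl) y
  calc LinearMap.trace ℂ _ EG
      = LinearMap.trace ℂ _ (EG ∘ₗ
          ∑ q : Γ ⧸ Γ', ∑ s ∈ hfin.toFinset, ι (q.out • s) ∘ₗ π (q.out • s)) := by
        rw [hid, LinearMap.comp_id]
    _ = ∑ q : Γ ⧸ Γ', ∑ s ∈ hfin.toFinset,
          LinearMap.trace ℂ V (periodizedKernel ρ hfree Γ' E (q.out • s)) := by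
        simp only [← Module.End.mul_eq_comp EG, Finset.mul_sum, map_sum]
        refine Finset.sum_congr rfl fun q _ => Finset.sum_congr rfl fun s _ => ?_
        rw [← hcomp, LinearMap.trace_comp_comm', LinearMap.comp_assoc]
        rfl
    _ = _ := by
        simp only [trace_periodizedKernel_smul hfree Γ' hE]
        simp [Subgroup.index_eq_card]

theorem norm_trace_periodizedKernel_le [FiniteDimensional ℂ V]
    (hfree : ∀ (γ : Γ) (y : Y), γ • y = y → γ = 1) (Γ' : Subgroup Γ)
    {E : (Y →₀ V) →ₗ[ℂ] (Y →₀ V)} {C : ℝ} (hC : ∀ φ, l1Norm (E φ) ≤ C * l1Norm φ) (y : Y) :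
    ‖LinearMap.trace ℂ V (periodizedKernel ρ hfree Γ' E y)‖ ≤ Module.finrank ℂ V * C := by
  let b := stdOrthonormalBasis ℂ V
  have hb (i) : ‖b i‖ = 1 := b.norm_eq_one i
  rw [LinearMap.trace_eq_sum_inner _ b]
  calc _ ≤ ∑ i, ‖inner ℂ (b i) (periodizedKernel ρ hfree Γ' E y (b i))‖ := norm_sum_le _ _
    _ ≤ ∑ _i : Fin (Module.finrank ℂ V), C := by
        refine Finset.sum_le_sum fun i _ => (norm_inner_le_norm _ _).trans ?_
        rw [hb, one_mul, periodizedKernel_apply]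
        simpa [l1Norm_single, hb] using
          (norm_smap_le hfree Γ' _ y).trans (hC (Finsupp.single y (b i)))
    _ = _ := by simp

theorem norm_kernelOfL_le [FiniteDimensional ℂ V] {E : (Y →₀ V) →ₗ[ℂ] (Y →₀ V)} {C : ℝ}
    (hC0 : 0 ≤ C) (hC : ∀ φ, l1Norm (E φ) ≤ C * l1Norm φ) (x y : Y) :
    ‖kernelOfL E x y‖ ≤ C := by
  refine ContinuousLinearMap.opNorm_le_bound _ hC0 fun v => ?_
  rw [← l1Norm_single y v]
  exact (norm_apply_le_l1Norm (E (Finsupp.single y v)) x).trans (hC _)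

/-- The trace as a continuous linear functional on continuous endomorphisms. -/
def traceCLM (V : Type*) [NormedAddCommGroup V] [InnerProductSpace ℂ V]
    [FiniteDimensional ℂ V] : (V →L[ℂ] V) →L[ℂ] ℂ :=
  LinearMap.toContinuousLinearMap (LinearMap.trace ℂ V ∘ₗ ContinuousLinearMap.coeLM ℂ)

theorem hasSum_trGammaHeat [FiniteDimensional ℂ V] {S : Set Y} (hfin : S.Finite)
    {D : (Y →₀ V) →ₗ[ℂ] (Y →₀ V)} {M : ℝ} (hM : 0 ≤ M)
    (hD : ∀ φ, l1Norm (D φ) ≤ M * l1Norm φ) (z : ℂ) :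
    HasSum (fun n : ℕ => z ^ n / (n.factorial : ℂ) *
      ∑ s ∈ hfin.toFinset, LinearMap.trace ℂ V (kernelOf (D ^ n) s s)) (trGammaHeat D z S) := by
  unfold trGammaHeat
  rw [finsum_mem_eq_finite_toFinset_sum _ hfin]
  simp only [Finset.mul_sum]
  refine hasSum_sum fun s _ => ?_
  have h : Summable fun n : ℕ => (z ^ n / (n.factorial : ℂ)) • kernelOfL (D ^ n) s s :=
    summable_exp_term_smul (C := 1) (M := M) (fun n => by
      simpa using norm_kernelOfL_le (pow_nonneg hM n) (l1Norm_pow_le hM hD n) s s) z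
  have := h.hasSum.mapL (traceCLM V)
  simp only [map_smul, smul_eq_mul] at this
  exact this

end Trace

/-- Let `D` be `Γ`-invariant of finite propagation speed and `(Γ_j)` a tower.
Set `h_j(t) := tr e^{−tD_{Γ_j}}/[Γ:Γ_j] − tr_Γ e^{−tD}`.  Then there is `Λ > 0`
such that for every real `λ > Λ` and every `s ∈ ℂ` with `Re s > −1`, the
integral `∫₀^∞ t^{s−1} h_j(t) e^{−tλ} dt` converges absolutely, and it tends to
`0` as `j → ∞`. -/
theorem trace_difference_mellin_tendsto_zero
    [MetricSpace Y] [Group Γ] [MulAction Γ Y]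
    [NormedAddCommGroup V] [InnerProductSpace ℂ V] [FiniteDimensional ℂ V]
    (hball : ∀ (y : Y) (R : ℝ), (Metric.closedBall y R).Finite)
    (hiso : ∀ γ : Γ, Isometry (fun y : Y => γ • y))
    (hfree : ∀ (γ : Γ) (y : Y), γ • y = y → γ = 1)
    (horb : Finite (MulAction.orbitRel.Quotient Γ Y))
    (ρ : Γ →* (V ≃ₗᵢ[ℂ] V))
    (D : (Y →₀ V) →ₗ[ℂ] (Y →₀ V))
    (hinv : IsEquivariantOp ρ D)
    (hprop : ∃ R : ℝ, HasPropSpeed D R)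
    (Γs : ℕ → Subgroup Γ) (htop : Γs 0 = ⊤)
    (hdec : ∀ j, Γs (j + 1) ≤ Γs j)
    (hnorm : ∀ j, (Γs j).Normal) (hfi : ∀ j, (Γs j).FiniteIndex)
    (hinter : (⨅ j, Γs j) = ⊥)
    (DG : ∀ j, equivSubmodule (Y := Y) ρ (Γs j) →ₗ[ℂ] equivSubmodule (Y := Y) ρ (Γs j))
    (hDG : ∀ j, IsPushdown ρ (Γs j) D (DG j))
    (S : Set Y) (hS : IsRepSet Γ S)
    (h : ℕ → ℝ → ℂ)
    (hdef : ∀ (j : ℕ) (t : ℝ),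
      h j t = trExp (DG j) (-(t : ℂ)) / ((Γs j).index : ℂ) - trGammaHeat D (-(t : ℂ)) S) :
    ∃ Λ : ℝ, 0 < Λ ∧ ∀ lam : ℝ, Λ < lam → ∀ s : ℂ, -1 < s.re →
      (∀ j : ℕ, MeasureTheory.IntegrableOn
        (fun t : ℝ => (t : ℂ) ^ (s - 1) * h j t * Complex.exp (-(↑(t * lam) : ℂ)))
        (Set.Ioi 0)) ∧
      Tendsto
        (fun j : ℕ => ∫ t in Set.Ioi (0 : ℝ),
          (t : ℂ) ^ (s - 1) * h j t * Complex.exp (-(↑(t * lam) : ℂ)))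
        atTop (nhds 0) := by
  have hfin := hS.finite
  obtain ⟨M, hM, hDM⟩ := hinv.exists_l1Norm_le hS hfin
  have hpow := l1Norm_pow_le hM hDM
  set T := hfin.toFinset
  let K (j n : ℕ) (s : Y) : ℂ := LinearMap.trace ℂ V (periodizedKernel ρ hfree (Γs j) (D ^ n) s)
  let k (n : ℕ) (s : Y) : ℂ := LinearMap.trace ℂ V (kernelOf (D ^ n) s s)
  have htrace (j n : ℕ) :
      LinearMap.trace ℂ _ (DG j ^ n) / ((Γs j).index : ℂ) = ∑ s ∈ T, K j n s := by
    have := hnorm j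
    have := hfi j
    rw [trace_pushdown hfree hS hfin (Γs j) (hinv.pow n) ((hDG j).pow n),
      mul_div_cancel_left₀ _ (Nat.cast_ne_zero.2 (hfi j).index_ne_zero)]
  have hKbound (j n : ℕ) : ‖∑ s ∈ T, K j n s‖ ≤ T.card * Module.finrank ℂ V * M ^ n := by
    refine (norm_sum_le_of_le _ fun s _ =>
      norm_trace_periodizedKernel_le hfree (Γs j) (hpow n) s).trans_eq ?_
    rw [Finset.sum_const, nsmul_eq_mul, mul_assoc]
  have hev (n : ℕ) : ∀ᶠ j in atTop, ∀ s ∈ T, K j n s = k n s := by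
    rw [Finset.eventually_all]
    intro s _
    let b := stdOrthonormalBasis ℂ V
    have : ∀ᶠ j in atTop, ∀ i, smap ρ (Γs j) ((D ^ n) (Finsupp.single s (b i))) s =
        (D ^ n) (Finsupp.single s (b i)) s :=
      eventually_all.2 fun i => eventually_smap_eq hfree hdec hinter _ s
    filter_upwards [this] with j hj
    simp only [K, k]
    rw [LinearMap.trace_eq_sum_inner _ b, LinearMap.trace_eq_sum_inner _ b]
    refine Finset.sum_congr rfl fun i _ => ?_
    rw [periodizedKernel_apply, hj]
    rfl
  have hkbound (n : ℕ) : ‖∑ s ∈ T, k n s‖ ≤ T.card * Module.finrank ℂ V * M ^ n := by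
    obtain ⟨j, hj⟩ := (hev n).exists
    rw [← Finset.sum_congr rfl hj]
    exact hKbound j n
  have hbound (j n : ℕ) : ‖∑ s ∈ T, K j n s - ∑ s ∈ T, k n s‖ ≤
      2 * (T.card * Module.finrank ℂ V) * M ^ n := by
    refine (norm_sub_le_of_le (hKbound j n) (hkbound n)).trans_eq ?_
    ring
  refine ⟨M + 1, by positivity, fun lam hlam s hs =>
    mellin_tendsto_zero_of_series hbound (fun j => ?_) (fun n => ?_) (fun j t => ?_)
      (by linarith) hs⟩
  · rw [sub_eq_zero]
    refine Finset.sum_congr rfl fun s _ => congrArg _ (LinearMap.ext fun v => ?_)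
    have h1 : (((1 : Γs j) : Γ)) • s = s := by simp
    simp [periodizedKernel_apply, smap_single_of_smul_eq hfree (Γs j) h1, kernelOf, -map_inv]
  · filter_upwards [hev n] with j hj
    rw [sub_eq_zero]
    exact Finset.sum_congr rfl hj
  · have h1 := (summable_exp_term_smul (hKbound j) (-(t : ℂ))).hasSum
    have h2 := hasSum_trGammaHeat hfin hM hDM (-(t : ℂ))
    have h3 := (h1.sub h2).tsum_eq
    rw [hdef, trExp, ← tsum_div_const]
    simp only [mul_div_assoc, htrace, mul_sub]
    exact h3.symm
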